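/- First performance difference lemma across transition kernels: for any policy π ∈ Π and any two transition kernels p, p', J_ρ(π,p) − J_ρ(π,p') = (1/(1−γ)) Σ_s d^{π,p'}_ρ(s) Σ_a π_{sa} Σ_{s'} (p_{sas'} − p'_{sas'}) · (c_{sas'} + γ v^{π,p}_{s'}). -/

import Mathlib

open scoped BigOperators

noncomputable section

namespace RMDPStmt

variable {S A : ℕ}

/-- `p` is a transition kernel: each `p s a` lies in the probability simplex `Δ^S`. -/
def IsKernel (p : Fin S → Fin A → Fin S → ℝ) : Prop :=
  ∀ s a, p s a ∈ stdSimplex ℝ (Fin S)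

/-- `π` is a stationary randomized policy: each `π s` lies in the simplex `Δ^A`. -/
def IsPolicy (π : Fin S → Fin A → ℝ) : Prop :=
  ∀ s, π s ∈ stdSimplex ℝ (Fin A)

/-- The state-to-state matrix `P^π`. -/
def Pmat (π : Fin S → Fin A → ℝ) (p : Fin S → Fin A → Fin S → ℝ) :
    Matrix (Fin S) (Fin S) ℝ :=
  Matrix.of fun s s' => ∑ a, π s a * p s a s'

/-- The expected one-step cost vector `c^π`. -/
def cvec (c : Fin S → Fin A → Fin S → ℝ) (π : Fin S → Fin A → ℝ)
    (p : Fin S → Fin A → Fin S → ℝ) : Fin S → ℝ :=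
  fun s => ∑ a, π s a * ∑ s', p s a s' * c s a s'

/-- Value function `v^{π,p}` as a discounted series. -/
def value (γ : ℝ) (c : Fin S → Fin A → Fin S → ℝ) (π : Fin S → Fin A → ℝ)
    (p : Fin S → Fin A → Fin S → ℝ) : Fin S → ℝ :=
  fun s => ∑' t : ℕ, γ ^ t * ((Pmat π p ^ t).mulVec (cvec c π p)) s

/-- The return `J_ρ(π,p)`. -/
def J (γ : ℝ) (c : Fin S → Fin A → Fin S → ℝ) (ρ : Fin S → ℝ)
    (π : Fin S → Fin A → ℝ) (p : Fin S → Fin A → Fin S → ℝ) : ℝ :=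
  ∑ s, ρ s * value γ c π p s

/-- The action-value function `q^{π,p}`. -/
def qval (γ : ℝ) (c : Fin S → Fin A → Fin S → ℝ) (π : Fin S → Fin A → ℝ)
    (p : Fin S → Fin A → Fin S → ℝ) : Fin S → Fin A → ℝ :=
  fun s a => ∑ s', p s a s' * (c s a s' + γ * value γ c π p s')

/-- The discounted state occupancy measure `d^{π,p}_ρ`. -/
def occ (γ : ℝ) (ρ : Fin S → ℝ) (π : Fin S → Fin A → ℝ)
    (p : Fin S → Fin A → Fin S → ℝ) : Fin S → ℝ :=
  fun s' => (1 - γ) * ∑' t : ℕ, γ ^ t * ∑ s, ρ s * (Pmat π p ^ t) s s'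

/-- Bregman divergence generated by `h`. -/
def breg {E : Type*} [NormedAddCommGroup E] [NormedSpace ℝ E]
    (h : E → ℝ) (x y : E) : ℝ :=
  h x - h y - fderiv ℝ h y (x - y)

/-- Weighted Bregman divergence `B_μ`. -/
def bregW {E : Type*} [NormedAddCommGroup E] [NormedSpace ℝ E]
    (μ : Fin S → ℝ) (h : E → ℝ) (x y : Fin S → E) : ℝ :=
  ∑ s, μ s * breg h (x s) (y s)

/-- Inner product of two action-indexed vectors. -/
def dotA (u v : Fin A → ℝ) : ℝ := ∑ a, u a * v a

/-- Inner product of two action-by-state arrays. -/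
def dotAS (u v : Fin A → Fin S → ℝ) : ℝ := ∑ a, ∑ s', u a s' * v a s'

/-- The robust objective `Φ(π) = sup_{p ∈ Amb} J_ρ(π,p)`. -/
def Phi (γ : ℝ) (c : Fin S → Fin A → Fin S → ℝ) (ρ : Fin S → ℝ)
    (Amb : Set (Fin S → Fin A → Fin S → ℝ)) (π : Fin S → Fin A → ℝ) : ℝ :=
  sSup ((fun p => J γ c ρ π p) '' Amb)

/-- The distribution mismatch coefficient
`M = sup_{π ∈ Π, p ∈ Amb} max_s d^{π,p}_ρ(s)/ρ_s`. -/
def mismatch (γ : ℝ) (ρ : Fin S → ℝ)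
    (Amb : Set (Fin S → Fin A → Fin S → ℝ)) : ℝ :=
  sSup {x : ℝ | ∃ (π : Fin S → Fin A → ℝ) (p : Fin S → Fin A → Fin S → ℝ),
    IsPolicy π ∧ p ∈ Amb ∧ ∃ s, x = occ γ ρ π p s / ρ s}


/-- The state-to-state matrix of a policy under a kernel is row stochastic. -/
lemma Pmat_mem_rowStochastic {π : Fin S → Fin A → ℝ} {p : Fin S → Fin A → Fin S → ℝ}
    (hπ : IsPolicy π) (hp : IsKernel p) : Pmat π p ∈ Matrix.rowStochastic ℝ (Fin S) := by
  refine Matrix.mem_rowStochastic_iff_sum.2 ⟨fun s s' => ?_, fun s => ?_⟩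
  · rw [Pmat, Matrix.of_apply]
    exact Finset.sum_nonneg fun a _ => mul_nonneg ((hπ s).1 a) ((hp s a).1 s')
  · simp only [Pmat, Matrix.of_apply]
    rw [Finset.sum_comm]
    simp only [← Finset.mul_sum, (hp s _).2, mul_one, (hπ s).2]

/-- The Neumann series of a discounted row stochastic matrix converges. -/
lemma summable_smul_pow {n : Type*} [Fintype n] [DecidableEq n] {γ : ℝ}
    (hγ : γ ∈ Set.Ioo (0 : ℝ) 1) {P : Matrix n n ℝ} (hP : P ∈ Matrix.rowStochastic ℝ n) :
    Summable fun t : ℕ => (γ • P) ^ t := by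
  refine Pi.summable.2 fun i => Pi.summable.2 fun j => ?_
  refine Summable.of_nonneg_of_le (fun t => ?_) (fun t => ?_)
    (summable_geometric_of_lt_one hγ.1.le hγ.2)
  · rw [smul_pow, Matrix.smul_apply, smul_eq_mul]
    exact mul_nonneg (pow_nonneg hγ.1.le t)
      (Matrix.nonneg_of_mem_rowStochastic (pow_mem hP t))
  · rw [smul_pow, Matrix.smul_apply, smul_eq_mul]
    exact mul_le_of_le_one_right (pow_nonneg hγ.1.le t)
      (Matrix.le_one_of_mem_rowStochastic (pow_mem hP t))

/-- Entrywise form of the Neumann series. -/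
lemma hasSum_pow_apply {n : Type*} [Fintype n] [DecidableEq n] {γ : ℝ}
    (hγ : γ ∈ Set.Ioo (0 : ℝ) 1) {P : Matrix n n ℝ} (hP : P ∈ Matrix.rowStochastic ℝ n)
    (i j : n) :
    HasSum (fun t : ℕ => γ ^ t * (P ^ t) i j) ((∑' t : ℕ, (γ • P) ^ t) i j) := by
  have h := Pi.hasSum.1 (Pi.hasSum.1 (summable_smul_pow hγ hP).hasSum i) j
  simpa only [smul_pow, Matrix.smul_apply, smul_eq_mul] using h

/-- The value function is the Neumann series applied to the expected one-step cost. -/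
lemma value_eq_mulVec {γ : ℝ} (hγ : γ ∈ Set.Ioo (0 : ℝ) 1) (c : Fin S → Fin A → Fin S → ℝ)
    {π : Fin S → Fin A → ℝ} {p : Fin S → Fin A → Fin S → ℝ}
    (hπ : IsPolicy π) (hp : IsKernel p) :
    value γ c π p = (∑' t : ℕ, (γ • Pmat π p) ^ t).mulVec (cvec c π p) := by
  funext s
  refine HasSum.tsum_eq ?_
  have h := hasSum_sum fun (j : Fin S) (_ : j ∈ Finset.univ) =>
    (hasSum_pow_apply hγ (Pmat_mem_rowStochastic hπ hp) s j).mul_right (cvec c π p j)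
  simpa only [Matrix.mulVec, dotProduct, Finset.mul_sum, mul_assoc] using h

/-- The occupancy measure is the normalized Neumann series applied to the initial
distribution. -/
lemma occ_eq_vecMul {γ : ℝ} (hγ : γ ∈ Set.Ioo (0 : ℝ) 1) (ρ : Fin S → ℝ)
    {π : Fin S → Fin A → ℝ} {p : Fin S → Fin A → Fin S → ℝ}
    (hπ : IsPolicy π) (hp : IsKernel p) :
    occ γ ρ π p = (1 - γ) • Matrix.vecMul ρ (∑' t : ℕ, (γ • Pmat π p) ^ t) := by
  funext s
  refine congrArg ((1 - γ) * ·) (HasSum.tsum_eq ?_)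
  have h := hasSum_sum fun (i : Fin S) (_ : i ∈ Finset.univ) =>
    (hasSum_pow_apply hγ (Pmat_mem_rowStochastic hπ hp) i s).mul_left (ρ i)
  simpa only [Matrix.vecMul, dotProduct, Finset.mul_sum, mul_left_comm] using h

/-- The Bellman equation for the value function. -/
lemma value_eq_cvec_add {γ : ℝ} (hγ : γ ∈ Set.Ioo (0 : ℝ) 1) (c : Fin S → Fin A → Fin S → ℝ)
    {π : Fin S → Fin A → ℝ} {p : Fin S → Fin A → Fin S → ℝ}
    (hπ : IsPolicy π) (hp : IsKernel p) :
    value γ c π p = cvec c π p + (γ • Pmat π p).mulVec (value γ c π p) := by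
  have h := (summable_smul_pow hγ (Pmat_mem_rowStochastic hπ hp)).one_sub_mul_tsum_pow
  have h' := congrArg (fun M => M.mulVec (cvec c π p)) h
  simp only [← Matrix.mulVec_mulVec, ← value_eq_mulVec hγ c hπ hp, Matrix.sub_mulVec,
    Matrix.one_mulVec] at h'
  exact sub_eq_iff_eq_add.1 h'

/-- The expected one-step cost plus discounted continuation `u`, in kernel form. -/
lemma cvec_add_mulVec_apply (γ : ℝ) (c : Fin S → Fin A → Fin S → ℝ)
    (π : Fin S → Fin A → ℝ) (p : Fin S → Fin A → Fin S → ℝ) (u : Fin S → ℝ) (s : Fin S) :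
    (cvec c π p + (γ • Pmat π p).mulVec u) s =
      ∑ a, π s a * ∑ s', p s a s' * (c s a s' + γ * u s') := by
  simp only [Pi.add_apply, cvec, Matrix.smul_mulVec, Pi.smul_apply, smul_eq_mul, Matrix.mulVec,
    dotProduct, Pmat, Matrix.of_apply, mul_add, Finset.sum_add_distrib, Finset.sum_mul,
    Finset.mul_sum]
  congr 1
  rw [Finset.sum_comm]
  exact Finset.sum_congr rfl fun a _ => Finset.sum_congr rfl fun s' _ => by ring

/-- The difference of two values is the Neumann series of the second kernel applied to the
difference of the two Bellman operators at the first value. -/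
lemma value_sub_value {γ : ℝ} (hγ : γ ∈ Set.Ioo (0 : ℝ) 1) (c : Fin S → Fin A → Fin S → ℝ)
    {π : Fin S → Fin A → ℝ} {p p' : Fin S → Fin A → Fin S → ℝ}
    (hπ : IsPolicy π) (hp : IsKernel p) (hp' : IsKernel p') :
    value γ c π p - value γ c π p' =
      (∑' t : ℕ, (γ • Pmat π p') ^ t).mulVec
        ((cvec c π p + (γ • Pmat π p).mulVec (value γ c π p)) -
          (cvec c π p' + (γ • Pmat π p').mulVec (value γ c π p))) := by
  have h := (summable_smul_pow hγ (Pmat_mem_rowStochastic hπ hp')).tsum_pow_mul_one_sub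
  have h' := congrArg (fun M => M.mulVec (value γ c π p)) h
  simp only [← Matrix.mulVec_mulVec, Matrix.sub_mulVec, Matrix.one_mulVec] at h'
  rw [← value_eq_cvec_add hγ c hπ hp, sub_add_eq_sub_sub_swap, Matrix.mulVec_sub, h',
    ← value_eq_mulVec hγ c hπ hp']

/-- First performance difference lemma across transition kernels. -/
theorem first_performance_difference_across_kernels
    {S A : ℕ} (hS : 0 < S) (hA : 0 < A)
    (γ : ℝ) (hγ : γ ∈ Set.Ioo (0 : ℝ) 1)
    (c : Fin S → Fin A → Fin S → ℝ)
    (hc : ∀ s a s', c s a s' ∈ Set.Icc (0 : ℝ) 1)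
    (ρ : Fin S → ℝ) (hρ : ρ ∈ stdSimplex ℝ (Fin S))
    (π : Fin S → Fin A → ℝ) (hπ : IsPolicy π)
    (p p' : Fin S → Fin A → Fin S → ℝ)
    (hp : IsKernel p) (hp' : IsKernel p') :
    J γ c ρ π p - J γ c ρ π p' =
      (1 / (1 - γ)) * ∑ s, occ γ ρ π p' s *
        ∑ a, π s a * ∑ s', (p s a s' - p' s a s') *
          (c s a s' + γ * value γ c π p s') := by
  have hne : 1 - γ ≠ 0 := sub_ne_zero.2 hγ.2.ne'
  have hB : ∀ s, ∑ a, π s a * ∑ s', (p s a s' - p' s a s') *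
      (c s a s' + γ * value γ c π p s') =
      ((cvec c π p + (γ • Pmat π p).mulVec (value γ c π p)) -
        (cvec c π p' + (γ • Pmat π p').mulVec (value γ c π p))) s := by
    intro s
    rw [Pi.sub_apply, cvec_add_mulVec_apply, cvec_add_mulVec_apply]
    simp only [sub_mul, Finset.sum_sub_distrib, mul_sub]
  simp only [hB]
  change ρ ⬝ᵥ value γ c π p - ρ ⬝ᵥ value γ c π p' = 1 / (1 - γ) * (occ γ ρ π p' ⬝ᵥ _)
  rw [← dotProduct_sub, value_sub_value hγ c hπ hp hp', occ_eq_vecMul hγ ρ hπ hp',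
    smul_dotProduct, smul_eq_mul, ← mul_assoc, one_div_mul_cancel hne, one_mul,
    Matrix.dotProduct_mulVec]

end RMDPStmt
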